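/- Let (u,θ) be a classical solution of the thermal Navier–Stokes system on 𝕋³ × [0,T] with θ₀ ≥ 1 on 𝕋³. Then the thermal enstrophy satisfies the a priori bound ν ∫₀^T ∫_{𝕋³} θ(x,t) |∇u(x,t)|² dx dt ≤ ½‖u₀‖²_{L²(𝕋³)}. -/

import Mathlib

open MeasureTheory Real
open scoped ENNReal

noncomputable section

/-- Points of `ℝ³`; `ℤ³`-periodic functions on `Sp` model functions on the torus `𝕋³`. -/
abbrev Sp : Type := Fin 3 → ℝ

/-- A fundamental cell for the torus `𝕋³ = ℝ³/ℤ³`; integrals over `𝕋³` are integrals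
over `cell`. -/
def cell : Set Sp := Set.Icc 0 1

/-- The `i`-th partial derivative `∂ᵢ f`. -/
def pd (i : Fin 3) (f : Sp → ℝ) (x : Sp) : ℝ := fderiv ℝ f x (Pi.single i 1)

/-- `ℤ³`-periodicity: such a function descends to the torus `𝕋³`. -/
def Periodic3 (f : Sp → ℝ) : Prop :=
  ∀ (x : Sp) (k : Fin 3 → ℤ), f (x + fun i => (k i : ℝ)) = f x

/-- `|∇u|²` for a vector field `u`. -/
def gradSqV (u : Sp → Fin 3 → ℝ) (x : Sp) : ℝ :=
  ∑ i, ∑ j, (pd i (fun y => u y j) x) ^ 2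

/-- `|∇²u|²` for a vector field `u`. -/
def hessSqV (u : Sp → Fin 3 → ℝ) (x : Sp) : ℝ :=
  ∑ i, ∑ j, ∑ k, (pd i (pd j (fun y => u y k)) x) ^ 2

/-- `|∇f|²` for a scalar field `f`. -/
def gradSqS (f : Sp → ℝ) (x : Sp) : ℝ := ∑ i, (pd i f x) ^ 2

/-- An axis-parallel cube in `ℝ³` with base point `a` and side length `r`. -/
def cube (a : Sp) (r : ℝ) : Set Sp := Set.Icc a (a + fun _ => r)

/-- The average `|Q|⁻¹ ∫_Q f dx` of a nonnegative function, valued in `ℝ≥0∞`. -/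
def avgE (Q : Set Sp) (f : Sp → ℝ) : ℝ≥0∞ :=
  (volume Q)⁻¹ * ∫⁻ x in Q, ENNReal.ofReal (f x)

/-- The Muckenhoupt `A₂` characteristic `Q₂(ω)`, the supremum over all cubes `Q ⊆ 𝕋³`
(side length `≤ 1`) of `(|Q|⁻¹∫_Q ω dx)(|Q|⁻¹∫_Q ω⁻¹ dx)`; `ω ∈ A₂` iff `Q2 ω < ⊤`. -/
def Q2 (ω : Sp → ℝ) : ℝ≥0∞ :=
  ⨆ (a : Sp) (r : ℝ) (_ : 0 < r) (_ : r ≤ 1),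
    avgE (cube a r) ω * avgE (cube a r) fun x => (ω x)⁻¹

/-- A classical solution `(u, θ)` (with pressure `p`) of the thermal Navier–Stokes system
`∂ₜu + (u·∇)u + ∇p − ν div(θ∇u) = 0`, `div u = 0`,
`∂ₜ(θ²) + u·∇(θ²) − κ div(θ∇(θ²)) = νθ|∇u|²` on `𝕋³ × [0,T]`, with `p` the mean-zero
solution of `Δp = ∂ᵢ∂ⱼ(νθ∂ᵢuⱼ − uᵢuⱼ)`, initial data `u₀` mean-zero and `θ₀ ≥ 1`. -/
structure ThermalNSE (ν κ T : ℝ) (u : ℝ → Sp → Fin 3 → ℝ) (θ : ℝ → Sp → ℝ)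
    (p : ℝ → Sp → ℝ) : Prop where
  T_pos : 0 < T
  smooth_u : ContDiff ℝ (⊤ : ℕ∞) fun q : ℝ × Sp => u q.1 q.2
  smooth_θ : ContDiff ℝ (⊤ : ℕ∞) fun q : ℝ × Sp => θ q.1 q.2
  smooth_p : ContDiff ℝ (⊤ : ℕ∞) fun q : ℝ × Sp => p q.1 q.2
  periodic_u : ∀ t j, Periodic3 fun x => u t x j
  periodic_θ : ∀ t, Periodic3 (θ t)
  periodic_p : ∀ t, Periodic3 (p t)
  div_free : ∀ t ∈ Set.Icc (0 : ℝ) T, ∀ x, (∑ i, pd i (fun y => u t y i) x) = 0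
  momentum : ∀ t ∈ Set.Icc (0 : ℝ) T, ∀ x, ∀ j,
    deriv (fun s => u s x j) t
      + (∑ i, u t x i * pd i (fun y => u t y j) x)
      + pd j (p t) x
      - ν * ∑ i, pd i (fun y => θ t y * pd i (fun z => u t z j) y) x = 0
  heat : ∀ t ∈ Set.Icc (0 : ℝ) T, ∀ x,
    deriv (fun s => θ s x ^ 2) t
      + (∑ i, u t x i * pd i (fun y => θ t y ^ 2) x)
      - κ * (∑ i, pd i (fun y => θ t y * pd i (fun z => θ t z ^ 2) y) x)
      = ν * θ t x * gradSqV (u t) x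
  p_mean_zero : ∀ t ∈ Set.Icc (0 : ℝ) T, ∫ x in cell, p t x = 0
  p_poisson : ∀ t ∈ Set.Icc (0 : ℝ) T, ∀ x,
    (∑ i, pd i (pd i (p t)) x)
      = ∑ i, ∑ j, pd i (pd j fun y =>
          ν * θ t y * pd i (fun z => u t z j) y - u t y i * u t y j) x
  u0_mean_zero : ∀ j, ∫ x in cell, u 0 x j = 0
  θ0_ge_one : ∀ x, 1 ≤ θ 0 x

theorem contDiff_pd {f : Sp → ℝ} (hf : ContDiff ℝ (⊤ : ℕ∞) f) (i : Fin 3) :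
    ContDiff ℝ (⊤ : ℕ∞) (pd i f) :=
  (hf.fderiv_right (m := (⊤ : ℕ∞)) (by simp)).clm_apply contDiff_const

/-- Spatial derivatives of jointly smooth functions are jointly smooth. -/
theorem contDiff_pd_uncurry {f : ℝ → Sp → ℝ}
    (hf : ContDiff ℝ (⊤ : ℕ∞) fun q : ℝ × Sp => f q.1 q.2) (i : Fin 3) :
    ContDiff ℝ (⊤ : ℕ∞) fun q : ℝ × Sp => pd i (f q.1) q.2 := by
  refine ContDiff.fderiv_apply (f := fun q : ℝ × Sp => f q.1) (m := (⊤ : ℕ∞)) ?_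
    contDiff_snd contDiff_const (by simp)
  exact hf.comp ((contDiff_fst.comp contDiff_fst).prodMk contDiff_snd)

/-- The time derivative of a jointly smooth function is jointly smooth. -/
theorem contDiff_deriv_uncurry {f : ℝ → Sp → ℝ}
    (hf : ContDiff ℝ (⊤ : ℕ∞) fun q : ℝ × Sp => f q.1 q.2) :
    ContDiff ℝ (⊤ : ℕ∞) fun q : ℝ × Sp => deriv (fun s => f s q.2) q.1 := by
  refine ContDiff.fderiv_apply (f := fun (q : ℝ × Sp) s => f s q.2) (m := (⊤ : ℕ∞)) ?_
    contDiff_fst contDiff_const (by simp)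
  exact hf.comp (contDiff_snd.prodMk (contDiff_snd.comp contDiff_fst))

theorem pd_add {f g : Sp → ℝ} {x : Sp} (i : Fin 3) (hf : DifferentiableAt ℝ f x)
    (hg : DifferentiableAt ℝ g x) : pd i (fun y => f y + g y) x = pd i f x + pd i g x := by
  simp [pd, fderiv_fun_add hf hg]

theorem pd_sub {f g : Sp → ℝ} {x : Sp} (i : Fin 3) (hf : DifferentiableAt ℝ f x)
    (hg : DifferentiableAt ℝ g x) : pd i (fun y => f y - g y) x = pd i f x - pd i g x := by
  simp [pd, fderiv_fun_sub hf hg]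

theorem pd_mul {f g : Sp → ℝ} {x : Sp} (i : Fin 3) (hf : DifferentiableAt ℝ f x)
    (hg : DifferentiableAt ℝ g x) :
    pd i (fun y => f y * g y) x = pd i f x * g x + f x * pd i g x := by
  simp [pd, fderiv_fun_mul hf hg]
  ring

theorem pd_const_mul {f : Sp → ℝ} {x : Sp} (i : Fin 3) (c : ℝ)
    (hf : DifferentiableAt ℝ f x) : pd i (fun y => c * f y) x = c * pd i f x := by
  simp [pd, fderiv_const_mul hf]

theorem pd_sum {ι : Type*} {s : Finset ι} {f : ι → Sp → ℝ} {x : Sp} (i : Fin 3)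
    (hf : ∀ j ∈ s, DifferentiableAt ℝ (f j) x) :
    pd i (fun y => ∑ j ∈ s, f j y) x = ∑ j ∈ s, pd i (f j) x := by
  simp [pd, fderiv_fun_sum hf]

theorem Periodic3.pd {f : Sp → ℝ} (hf : Periodic3 f) (i : Fin 3) : Periodic3 (pd i f) := by
  intro x k
  have h : (fun y => f (y + fun i => (k i : ℝ))) = f := funext fun y => hf y k
  unfold _root_.pd
  rw [← fderiv_comp_add_right, h]

/-- The divergence of a smooth periodic vector field integrates to zero over the cell. -/
theorem integral_cell_divergence_eq_zero {F : Fin 3 → Sp → ℝ}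
    (hF : ∀ i, ContDiff ℝ (⊤ : ℕ∞) (F i)) (hper : ∀ i, Periodic3 (F i)) :
    ∫ x in cell, ∑ i, pd i (F i) x = 0 := by
  have key := integral_divergence_of_hasFDerivAt_off_countable' (n := 2) (0 : Sp) 1
    zero_le_one F (fun i => fderiv ℝ (F i)) ∅ Set.countable_empty
    (fun i => (hF i).continuous.continuousOn)
    (fun x _ i => ((hF i).differentiable (by simp) x).hasFDerivAt)
    ((continuous_finsetSum _ fun i _ => (contDiff_pd (hF i) i).continuous).continuousOn
      |>.integrableOn_compact isCompact_Icc)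
  refine key.trans (Finset.sum_eq_zero fun i _ => sub_eq_zero.2 ?_)
  congr 1 with y
  refine Eq.trans ?_ (hper i _ (Pi.single i 1))
  congr 1
  ext j
  refine Fin.succAboveCases i ?_ (fun j => ?_) j <;> simp

/-- The flux of kinetic energy `u (|u|²/2 + p) - ν θ ∇(|u|²/2)`. -/
def energyFlux (ν : ℝ) (v : Sp → Fin 3 → ℝ) (τ P : Sp → ℝ) (i : Fin 3) (x : Sp) : ℝ :=
  v x i * ((1 / 2) * (∑ j, v x j * v x j) + P x)
    - ν * ∑ j, v x j * (τ x * pd i (fun y => v y j) x)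

theorem contDiff_energyFlux (ν : ℝ) {v : Sp → Fin 3 → ℝ} {τ P : Sp → ℝ}
    (hv : ∀ j, ContDiff ℝ (⊤ : ℕ∞) fun x => v x j) (hτ : ContDiff ℝ (⊤ : ℕ∞) τ)
    (hP : ContDiff ℝ (⊤ : ℕ∞) P) (i : Fin 3) :
    ContDiff ℝ (⊤ : ℕ∞) (energyFlux ν v τ P i) := by
  have hd := fun j => contDiff_pd (hv j) i
  unfold energyFlux
  fun_prop

theorem periodic3_energyFlux (ν : ℝ) {v : Sp → Fin 3 → ℝ} {τ P : Sp → ℝ}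
    (hv : ∀ j, Periodic3 fun x => v x j) (hτ : Periodic3 τ) (hP : Periodic3 P) (i : Fin 3) :
    Periodic3 (energyFlux ν v τ P i) := by
  intro x k
  have hd := fun j => (hv j).pd i x k
  have hv' := fun j => hv j x k
  simp only at hv'
  simp only [energyFlux, hv', hd, hτ x k, hP x k]

theorem pd_energyFlux (ν : ℝ) {v : Sp → Fin 3 → ℝ} {τ P : Sp → ℝ}
    (hv : ∀ j, ContDiff ℝ (⊤ : ℕ∞) fun x => v x j) (hτ : ContDiff ℝ (⊤ : ℕ∞) τ)
    (hP : ContDiff ℝ (⊤ : ℕ∞) P) (i : Fin 3) (x : Sp) :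
    pd i (energyFlux ν v τ P i) x =
      pd i (fun y => v y i) x * ((1 / 2) * (∑ j, v x j * v x j) + P x)
      + v x i * ((∑ j, v x j * pd i (fun y => v y j) x) + pd i P x)
      - ν * ∑ j, (pd i (fun y => v y j) x * (τ x * pd i (fun y => v y j) x)
        + v x j * pd i (fun y => τ y * pd i (fun z => v z j) y) x) := by
  have dv := fun j => (hv j).differentiable (by simp)
  have dτ := hτ.differentiable (by simp)
  have dP := hP.differentiable (by simp)
  have dd := fun j => (contDiff_pd (hv j) i).differentiable (by simp)
  unfold energyFlux
  rw [pd_sub i (by fun_prop) (by fun_prop), pd_mul i (by fun_prop) (by fun_prop),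
    pd_add i (by fun_prop) (by fun_prop), pd_const_mul i _ (by fun_prop),
    pd_const_mul i _ (by fun_prop), pd_sum i (fun j _ => by fun_prop),
    pd_sum i (fun j _ => by fun_prop)]
  congr 2
  · congr 2
    rw [Finset.mul_sum]
    refine Finset.sum_congr rfl fun j _ => ?_
    rw [pd_mul i (by fun_prop) (by fun_prop)]
    ring
  · refine Finset.sum_congr rfl fun j _ => ?_
    rw [pd_mul i (by fun_prop) (by fun_prop)]

namespace ThermalNSE

variable {ν κ T : ℝ} {u : ℝ → Sp → Fin 3 → ℝ} {θ p : ℝ → Sp → ℝ}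

theorem contDiff_component (h : ThermalNSE ν κ T u θ p) (j : Fin 3) :
    ContDiff ℝ (⊤ : ℕ∞) fun q : ℝ × Sp => u q.1 q.2 j :=
  contDiff_pi.1 h.smooth_u j

theorem contDiff_energy (h : ThermalNSE ν κ T u θ p) :
    ContDiff ℝ (⊤ : ℕ∞) fun q : ℝ × Sp => ∑ j, u q.1 q.2 j ^ 2 := by
  have hu := h.contDiff_component
  fun_prop

/-- The local balance of kinetic energy. -/
theorem local_energy_balance (h : ThermalNSE ν κ T u θ p) {t : ℝ} (ht : t ∈ Set.Icc 0 T)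
    (x : Sp) :
    ν * (θ t x * gradSqV (u t) x) =
      -(1 / 2) * deriv (fun s => ∑ j, u s x j ^ 2) t
        - ∑ i, pd i (energyFlux ν (u t) (θ t) (p t) i) x := by
  have hslice : ContDiff ℝ (⊤ : ℕ∞) fun y : Sp => (t, y) := contDiff_prodMk_right t
  have hu : ∀ j, ContDiff ℝ (⊤ : ℕ∞) fun y => u t y j :=
    fun j => (h.contDiff_component j).comp hslice
  have hθ : ContDiff ℝ (⊤ : ℕ∞) (θ t) := h.smooth_θ.comp hslice
  have hp : ContDiff ℝ (⊤ : ℕ∞) (p t) := h.smooth_p.comp hslice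
  have ht' : ∀ j, DifferentiableAt ℝ (fun s => u s x j) t := fun j =>
    ((h.contDiff_component j).comp (contDiff_prodMk_left x)).differentiable (by simp) t
  have hderiv : deriv (fun s => ∑ j, u s x j ^ 2) t =
      ∑ j, 2 * u t x j * deriv (fun s => u s x j) t := by
    rw [deriv_fun_sum fun j _ => (ht' j).fun_pow 2]
    refine Finset.sum_congr rfl fun j _ => ?_
    rw [deriv_fun_pow (ht' j)]
    simp
  rw [hderiv]
  simp only [pd_energyFlux ν hu hθ hp]
  have hm := h.momentum t ht x
  have h0 := hm 0
  have h1 := hm 1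
  have h2 := hm 2
  have hdiv := h.div_free t ht x
  simp only [gradSqV, Fin.sum_univ_three] at h0 h1 h2 hdiv ⊢
  linear_combination u t x 0 * h0 + u t x 1 * h1 + u t x 2 * h2
    + ((1 / 2) * (u t x 0 * u t x 0 + u t x 1 * u t x 1 + u t x 2 * u t x 2) + p t x) * hdiv

/-- The balance of kinetic energy integrated over the torus. -/
theorem energy_balance (h : ThermalNSE ν κ T u θ p) {t : ℝ} (ht : t ∈ Set.Icc 0 T) :
    ν * (∫ x in cell, θ t x * gradSqV (u t) x) =
      -(1 / 2) * ∫ x in cell, deriv (fun s => ∑ j, u s x j ^ 2) t := by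
  have hslice : ContDiff ℝ (⊤ : ℕ∞) fun y : Sp => (t, y) := contDiff_prodMk_right t
  have hu : ∀ j, ContDiff ℝ (⊤ : ℕ∞) fun y => u t y j :=
    fun j => (h.contDiff_component j).comp hslice
  have hθ : ContDiff ℝ (⊤ : ℕ∞) (θ t) := h.smooth_θ.comp hslice
  have hp : ContDiff ℝ (⊤ : ℕ∞) (p t) := h.smooth_p.comp hslice
  have hF := contDiff_energyFlux ν hu hθ hp
  have hint : IntegrableOn (fun x => deriv (fun s => ∑ j, u s x j ^ 2) t) cell :=
    ((contDiff_deriv_uncurry (f := fun s x => ∑ j, u s x j ^ 2) h.contDiff_energy).comp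
      hslice).continuous.continuousOn.integrableOn_compact isCompact_Icc
  have hintF : IntegrableOn
      (fun x => ∑ i, pd i (energyFlux ν (u t) (θ t) (p t) i) x) cell :=
    (continuous_finsetSum _ fun i _ => (contDiff_pd (hF i) i).continuous).continuousOn
      |>.integrableOn_compact isCompact_Icc
  rw [← integral_const_mul, integral_congr_ae (ae_of_all _ (h.local_energy_balance ht)),
    integral_sub (hint.const_mul _) hintF, integral_const_mul,
    integral_cell_divergence_eq_zero hF
      (periodic3_energyFlux ν (h.periodic_u t) (h.periodic_θ t) (h.periodic_p t)), sub_zero]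

/-- The energy identity. -/
theorem energy_identity (h : ThermalNSE ν κ T u θ p) :
    ν * (∫ t in Set.Icc (0 : ℝ) T, ∫ x in cell, θ t x * gradSqV (u t) x) =
      (1 / 2) * (∫ x in cell, ∑ j, u 0 x j ^ 2) - (1 / 2) * ∫ x in cell, ∑ j, u T x j ^ 2 := by
  have hE := h.contDiff_energy
  have hd := contDiff_deriv_uncurry (f := fun s x => ∑ j, u s x j ^ 2) hE
  have hint (t : ℝ) : IntegrableOn (fun x => ∑ j, u t x j ^ 2) cell :=
    (hE.comp (contDiff_prodMk_right t)).continuous.continuousOn.integrableOn_compact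
      isCompact_Icc
  have hswap : Integrable (Function.uncurry fun t x => deriv (fun s => ∑ j, u s x j ^ 2) t)
      ((volume.restrict (Set.Icc 0 T)).prod (volume.restrict cell)) := by
    rw [Measure.prod_restrict]
    exact hd.continuous.continuousOn.integrableOn_compact (isCompact_Icc.prod isCompact_Icc)
  have htime (x : Sp) : ∫ t in Set.Icc 0 T, deriv (fun s => ∑ j, u s x j ^ 2) t =
      ∑ j, u T x j ^ 2 - ∑ j, u 0 x j ^ 2 := by
    rw [integral_Icc_eq_integral_Ioc, ← intervalIntegral.integral_of_le h.T_pos.le]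
    refine intervalIntegral.integral_deriv_eq_sub
      (fun t _ => (hE.comp (contDiff_prodMk_left x)).differentiable (by simp) t) ?_
    exact (hd.comp (contDiff_prodMk_left x)).continuous.intervalIntegrable _ _
  rw [← integral_const_mul, setIntegral_congr_fun measurableSet_Icc
    (fun t ht => h.energy_balance ht), integral_const_mul, integral_integral_swap hswap]
  simp only [htime]
  rw [integral_sub (hint T) (hint 0)]
  ring

end ThermalNSE

/-- **Thermal enstrophy a priori bound, thermal Navier–Stokes.**
`ν ∫₀^T ∫_{𝕋³} θ|∇u|² dx dt ≤ ½‖u₀‖²_{L²}`. -/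
theorem thermalNSE_thermal_enstrophy_bound (ν κ T : ℝ) (hν : 0 < ν) (hκ : 0 < κ)
    (u : ℝ → Sp → Fin 3 → ℝ) (θ p : ℝ → Sp → ℝ)
    (h : ThermalNSE ν κ T u θ p) :
    ν * (∫ t in Set.Icc (0 : ℝ) T, ∫ x in cell, θ t x * gradSqV (u t) x)
      ≤ (1 / 2) * ∫ x in cell, ∑ j, u 0 x j ^ 2 := by
  rw [h.energy_identity]
  have : 0 ≤ ∫ x in cell, ∑ j, u T x j ^ 2 := by positivity
  linarith
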